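/- arXiv:2509.19055 — 6 statements merged into one kernel-verified Lean document; each statement's English description precedes it below -/
import Mathlib

section
/- Let (Y,Σ,ν) be a σ-finite measure space and let Q be a bounded linear operator on the complex Hilbert space L²(Y). Then Q is a multiplication operator if and only if for all f, g ∈ L²(Y) with f·g = 0 almost everywhere one has (Qf)·g = 0 almost everywhere. -/
open MeasureTheory

/-- `Q` is a multiplication operator on `L²(Y)`: there is an essentially bounded
measurable function `m : Y → ℂ` with `Q f = m • f` a.e. for every `f`. -/
def IsMultiplicationOperator {Y : Type*} [MeasurableSpace Y] (ν : Measure Y)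
    (Q : Lp ℂ 2 ν →L[ℂ] Lp ℂ 2 ν) : Prop :=
  ∃ m : Y → ℂ, Measurable m ∧ (∃ M : ℝ, ∀ᵐ y ∂ν, ‖m y‖ ≤ M) ∧
    ∀ f : Lp ℂ 2 ν, ⇑(Q f) =ᵐ[ν] fun y => m y * f y

section DisjointSupports

variable {Y : Type*} [MeasurableSpace Y] {ν : Measure Y}

/-- On a `σ`-finite space there is a function in `L²` that vanishes almost nowhere. -/
lemma exists_Lp_two_ae_ne_zero (ν : Measure Y) [SigmaFinite ν] :
    ∃ w : Lp ℂ 2 ν, ∀ᵐ y ∂ν, w y ≠ 0 := by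
  obtain ⟨g, hpos, hmeas, hlt⟩ := exists_pos_lintegral_lt_of_sigmaFinite ν one_ne_zero
  have hm : Measurable fun y => ((Real.sqrt (g y) : ℝ) : ℂ) := by fun_prop
  have hL : MemLp (fun y => ((Real.sqrt (g y) : ℝ) : ℂ)) 2 ν := by
    refine (memLp_two_iff_integrable_sq_norm hm.aestronglyMeasurable).2 ⟨by fun_prop, ?_⟩
    refine lt_of_le_of_lt (le_of_eq (lintegral_congr fun y => ?_)) (hlt.trans ENNReal.one_lt_top)
    simp [Real.sq_sqrt]
  refine ⟨hL.toLp, ?_⟩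
  filter_upwards [hL.coeFn_toLp] with y hy
  rw [hy]
  simpa [Real.sqrt_eq_zero] using (hpos y).ne'

variable {Q : Lp ℂ 2 ν →L[ℂ] Lp ℂ 2 ν}

/-- An operator preserving disjointness of supports does not enlarge supports. -/
lemma ae_eq_zero_of_ae_eq_zero_on [SigmaFinite ν]
    (hQ : ∀ f g : Lp ℂ 2 ν, ((fun y => f y * g y) =ᵐ[ν] 0) → (fun y => Q f y * g y) =ᵐ[ν] 0)
    {s : Set Y} (hs : MeasurableSet s) {f : Lp ℂ 2 ν} (hf : ∀ᵐ y ∂ν, y ∈ s → f y = 0) :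
    ∀ᵐ y ∂ν, y ∈ s → Q f y = 0 := by
  obtain ⟨w, hw⟩ := exists_Lp_two_ae_ne_zero ν
  have hg := ((Lp.memLp w).indicator hs).coeFn_toLp
  have h := hQ f ((Lp.memLp w).indicator hs).toLp (by
    filter_upwards [hg, hf] with y hy hfy
    by_cases hys : y ∈ s <;> simp [hy, hys, hfy])
  filter_upwards [hg, h, hw] with y hy hQy hwy hys
  simpa [hy, hys, hwy] using hQy

/-- An operator preserving disjointness of supports commutes with restriction to a set. -/
lemma ae_eq_indicator [SigmaFinite ν]
    (hQ : ∀ f g : Lp ℂ 2 ν, ((fun y => f y * g y) =ᵐ[ν] 0) → (fun y => Q f y * g y) =ᵐ[ν] 0)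
    {s : Set Y} (hs : MeasurableSet s) (f : Lp ℂ 2 ν) :
    Q ((Lp.memLp f).indicator hs).toLp =ᵐ[ν] s.indicator (Q f) := by
  set F := ((Lp.memLp f).indicator hs).toLp with hF
  have hFf : F =ᵐ[ν] s.indicator f := MemLp.coeFn_toLp _
  have h1 : ∀ᵐ y ∂ν, y ∈ sᶜ → Q F y = 0 := by
    refine ae_eq_zero_of_ae_eq_zero_on hQ hs.compl ?_
    filter_upwards [hFf] with y hy hys
    rw [hy, Set.indicator_of_notMem hys]
  have h2 : ∀ᵐ y ∂ν, y ∈ s → Q (f - F) y = 0 := by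
    refine ae_eq_zero_of_ae_eq_zero_on hQ hs ?_
    filter_upwards [hFf, Lp.coeFn_sub f F] with y hy hsub hys
    rw [hsub, Pi.sub_apply, hy, Set.indicator_of_mem hys, sub_self]
  rw [map_sub] at h2
  filter_upwards [h1, h2, Lp.coeFn_sub (Q f) (Q F)] with y h1y h2y hsub
  by_cases hys : y ∈ s
  · rw [Set.indicator_of_mem hys]
    have := h2y hys
    rw [hsub, Pi.sub_apply, sub_eq_zero] at this
    exact this.symm
  · rw [Set.indicator_of_notMem hys, h1y hys]

/-- An operator preserving disjointness of supports is bounded pointwise by its norm. -/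
lemma ae_norm_apply_le [SigmaFinite ν]
    (hQ : ∀ f g : Lp ℂ 2 ν, ((fun y => f y * g y) =ᵐ[ν] 0) → (fun y => Q f y * g y) =ᵐ[ν] 0)
    (f : Lp ℂ 2 ν) : ∀ᵐ y ∂ν, ‖Q f y‖ ≤ ‖Q‖ * ‖f y‖ := by
  have key (F : Y → ℂ) (s : Set Y) (hs : MeasurableSet s) :
      ∫⁻ y in s, ‖F y‖ₑ ^ (2 : ℝ) ∂ν = eLpNorm (s.indicator F) 2 ν ^ (2 : ℝ) := by
    have h := eLpNorm_nnreal_pow_eq_lintegral (f := F) (μ := ν.restrict s) (p := 2) two_ne_zero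
    rw [eLpNorm_indicator_eq_eLpNorm_restrict hs]
    simpa using h.symm
  have hle : (fun y => ‖Q f y‖ₑ ^ (2 : ℝ)) ≤ᵐ[ν] fun y => ‖Q‖ₑ ^ (2 : ℝ) * ‖f y‖ₑ ^ (2 : ℝ) := by
    refine ae_le_of_forall_setLIntegral_le_of_sigmaFinite
      ((Lp.stronglyMeasurable (Q f)).measurable.enorm.pow_const _) fun s hs _ => ?_
    rw [lintegral_const_mul _ ((Lp.stronglyMeasurable f).measurable.enorm.pow_const _),
      key _ s hs, key _ s hs, ← ENNReal.mul_rpow_of_nonneg _ _ zero_le_two]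
    gcongr
    rw [← eLpNorm_congr_ae (ae_eq_indicator hQ hs f),
      ← eLpNorm_congr_ae ((Lp.memLp f).indicator hs).coeFn_toLp, ← Lp.enorm_def, ← Lp.enorm_def]
    exact Q.le_opENorm _
  filter_upwards [hle] with y hy
  rw [← ENNReal.mul_rpow_of_nonneg _ _ zero_le_two,
    ENNReal.rpow_le_rpow_iff zero_lt_two] at hy
  simpa [enorm_eq_nnnorm, ← ENNReal.coe_mul, ← NNReal.coe_le_coe] using hy

/-- An operator preserving disjointness of supports multiplies all functions by the same
factors: comparing `f` with the multiples `c • u` for `c` in a countable dense set determines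
`Q f` from `Q u`. -/
lemma ae_apply_eq_div_mul [SigmaFinite ν]
    (hQ : ∀ f g : Lp ℂ 2 ν, ((fun y => f y * g y) =ᵐ[ν] 0) → (fun y => Q f y * g y) =ᵐ[ν] 0)
    {u : Lp ℂ 2 ν} (hu : ∀ᵐ y ∂ν, u y ≠ 0) (f : Lp ℂ 2 ν) :
    Q f =ᵐ[ν] fun y => Q u y / u y * f y := by
  have h : ∀ᵐ y ∂ν, ∀ n, ‖Q f y - TopologicalSpace.denseSeq ℂ n * Q u y‖ ≤
      ‖Q‖ * ‖f y - TopologicalSpace.denseSeq ℂ n * u y‖ := by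
    refine ae_all_iff.2 fun n => ?_
    set c := TopologicalSpace.denseSeq ℂ n
    have hb := ae_norm_apply_le hQ (f - c • u)
    rw [map_sub, map_smul] at hb
    filter_upwards [hb, Lp.coeFn_sub f (c • u), Lp.coeFn_smul c u,
      Lp.coeFn_sub (Q f) (c • Q u), Lp.coeFn_smul c (Q u)] with y hy h1 h2 h3 h4
    rw [h1, h3, Pi.sub_apply, Pi.sub_apply, h2, h4] at hy
    simpa using hy
  filter_upwards [h, hu] with y hy huy
  have hall : ∀ c : ℂ, ‖Q f y - c * Q u y‖ ≤ ‖Q‖ * ‖f y - c * u y‖ := by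
    intro c
    refine (TopologicalSpace.denseRange_denseSeq ℂ).induction_on
      (p := fun c => ‖Q f y - c * Q u y‖ ≤ ‖Q‖ * ‖f y - c * u y‖) c ?_ hy
    exact isClosed_le (by fun_prop) (by fun_prop)
  have h0 := hall (f y / u y)
  rw [div_mul_cancel₀ _ huy, sub_self, norm_zero, mul_zero, norm_le_zero_iff, sub_eq_zero] at h0
  rw [h0]
  ring

end DisjointSupports

/-- Zaanen's characterisation: `Q` is a multiplication operator iff `f · g = 0` a.e.
implies `(Q f) · g = 0` a.e. -/
theorem multiplication_iff_disjoint_supports {Y : Type*} [MeasurableSpace Y]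
    (ν : Measure Y) [SigmaFinite ν] (Q : Lp ℂ 2 ν →L[ℂ] Lp ℂ 2 ν) :
    IsMultiplicationOperator ν Q ↔
      ∀ f g : Lp ℂ 2 ν, ((fun y => f y * g y) =ᵐ[ν] 0) →
        (fun y => Q f y * g y) =ᵐ[ν] 0 := by
  constructor
  · rintro ⟨m, -, -, hm⟩ f g hfg
    filter_upwards [hm f, hfg] with y hy hfgy
    simp only [Pi.zero_apply] at hfgy ⊢
    rw [hy, mul_assoc, hfgy, mul_zero]
  · intro hQ
    obtain ⟨u, hu⟩ := exists_Lp_two_ae_ne_zero ν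
    refine ⟨fun y => Q u y / u y, (Lp.stronglyMeasurable (Q u)).measurable.div
      (Lp.stronglyMeasurable u).measurable, ⟨‖Q‖, ?_⟩, ae_apply_eq_div_mul hQ hu⟩
    filter_upwards [ae_norm_apply_le hQ u, hu] with y hy huy
    rwa [norm_div, div_le_iff₀ (norm_pos_iff.2 huy)]
end

section
/- Let (Y,Σ,ν) be a σ-finite measure space and let Q be a bounded linear operator on the complex Hilbert space L²(Y). Then Q is a multiplication operator if and only if Q is a finite linear combination (with complex coefficients) of bounded operators T on L²(Y) such that both I − T and I + T are positive operators. -/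
open MeasureTheory
open scoped ComplexOrder

/-- A bounded operator on `L²(Y)` is positive if it maps functions that are a.e.
real-valued and nonnegative to functions that are a.e. real-valued and nonnegative.
(Here `0 ≤ z` for `z : ℂ` means `z` is a nonnegative real number.) -/
def IsPositiveOperator {Y : Type*} [MeasurableSpace Y] (ν : Measure Y)
    (T : Lp ℂ 2 ν →L[ℂ] Lp ℂ 2 ν) : Prop :=
  ∀ f : Lp ℂ 2 ν, (∀ᵐ y ∂ν, 0 ≤ f y) → ∀ᵐ y ∂ν, 0 ≤ T f y

section

variable {Y : Type*} [MeasurableSpace Y] {ν : Measure Y}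

/-- An essentially bounded measurable function induces a multiplication operator. -/
theorem exists_clm_coeFn_ae_eq_mul {m : Y → ℂ} (hm : Measurable m) {M : ℝ}
    (hM : ∀ᵐ y ∂ν, ‖m y‖ ≤ M) :
    ∃ T : Lp ℂ 2 ν →L[ℂ] Lp ℂ 2 ν, ∀ f : Lp ℂ 2 ν, ⇑(T f) =ᵐ[ν] fun y => m y * f y := by
  have hmem : MemLp m ⊤ ν := memLp_top_of_bound hm.aestronglyMeasurable M hM
  refine ⟨(ContinuousLinearMap.mul ℂ ℂ).holderL ν ⊤ 2 2 hmem.toLp, fun f => ?_⟩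
  filter_upwards [(ContinuousLinearMap.mul ℂ ℂ).coeFn_holder (r := 2) hmem.toLp f,
    hmem.coeFn_toLp] with y hy hmy
  simp [hy, hmy]

theorem Complex.norm_le_re_of_sub_nonneg_of_add_nonneg {z w : ℂ} (h₁ : 0 ≤ w - z)
    (h₂ : 0 ≤ w + z) : ‖z‖ ≤ w.re := by
  obtain ⟨h₁re, h₁im⟩ := Complex.nonneg_iff.mp h₁
  obtain ⟨h₂re, h₂im⟩ := Complex.nonneg_iff.mp h₂
  simp only [Complex.sub_re, Complex.add_re, Complex.sub_im, Complex.add_im] at *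
  have hz : z = (z.re : ℂ) := Complex.ext (by simp) (by simp; linarith)
  rw [hz, Complex.norm_real, Real.norm_eq_abs, abs_le]
  constructor <;> linarith

theorem IsPositiveOperator.norm_apply_le {T : Lp ℂ 2 ν →L[ℂ] Lp ℂ 2 ν}
    (h₁ : IsPositiveOperator ν (1 - T)) (h₂ : IsPositiveOperator ν (1 + T)) {f : Lp ℂ 2 ν}
    (hf : ∀ᵐ y ∂ν, 0 ≤ f y) : ∀ᵐ y ∂ν, ‖T f y‖ ≤ (f y).re := by
  filter_upwards [h₁ f hf, h₂ f hf, Lp.coeFn_sub f (T f), Lp.coeFn_add f (T f)]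
    with y hy₁ hy₂ hsub hadd
  simp only [sub_apply, add_apply, one_apply_eq_self, hsub, hadd, Pi.sub_apply, Pi.add_apply] at hy₁ hy₂
  exact Complex.norm_le_re_of_sub_nonneg_of_add_nonneg hy₁ hy₂

/-- If `h` vanishes almost nowhere, the restrictions of `h` to measurable sets span a dense
subspace of `L²`. -/
theorem topologicalClosure_span_indicator_eq_top {h : Lp ℂ 2 ν} (hh : ∀ᵐ y ∂ν, h y ≠ 0) :
    (Submodule.span ℂ {f : Lp ℂ 2 ν |
      ∃ A, MeasurableSet A ∧ ⇑f =ᵐ[ν] A.indicator h}).topologicalClosure = ⊤ := by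
  rw [Submodule.topologicalClosure_eq_top_iff, Submodule.eq_bot_iff]
  intro g hg
  rw [Submodule.mem_orthogonal] at hg
  have hzero := (L2.integrable_inner (𝕜 := ℂ) h g).ae_eq_zero_of_forall_setIntegral_eq_zero
    fun A hA _ => by
      have hmem : MemLp (A.indicator h) 2 ν := (Lp.memLp h).indicator hA
      have hinner := hg hmem.toLp (Submodule.subset_span ⟨A, hA, hmem.coeFn_toLp⟩)
      rw [L2.inner_def] at hinner
      rw [← integral_indicator hA, ← hinner]
      refine integral_congr_ae ?_
      filter_upwards [hmem.coeFn_toLp] with y hy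
      by_cases hyA : y ∈ A <;> simp [hy, hyA]
  refine (Lp.eq_zero_iff_ae_eq_zero).mpr ?_
  filter_upwards [hzero, hh] with y hy hhy
  simpa [hhy] using hy

theorem exists_Lp_two_pos (ν : Measure Y) [SigmaFinite ν] :
    ∃ h : Lp ℂ 2 ν, ∀ᵐ y ∂ν, 0 < h y := by
  obtain ⟨g, hg_pos, hg_meas, hg_int⟩ :=
    exists_pos_lintegral_lt_of_sigmaFinite ν (ε := 1) one_ne_zero
  have hmeas : Measurable fun y => ((Real.sqrt (g y) : ℝ) : ℂ) := by fun_prop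
  have hmem : MemLp (fun y => ((Real.sqrt (g y) : ℝ) : ℂ)) 2 ν := by
    rw [memLp_two_iff_integrable_sq_norm hmeas.aestronglyMeasurable]
    have hint : Integrable (fun y => (g y : ℝ)) ν := by
      refine ⟨by fun_prop, ?_⟩
      simpa [HasFiniteIntegral] using hg_int.trans ENNReal.one_lt_top
    simpa using hint
  refine ⟨hmem.toLp, ?_⟩
  filter_upwards [hmem.coeFn_toLp] with y hy
  rw [hy]
  exact_mod_cast Real.sqrt_pos.mpr (hg_pos y)

/-- An operator `T` with `-I ≤ T ≤ I` acts on restrictions of a nonnegative function `h` through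
the restrictions of `T h`. -/
theorem IsPositiveOperator.apply_ae_eq_indicator {T : Lp ℂ 2 ν →L[ℂ] Lp ℂ 2 ν}
    (h₁ : IsPositiveOperator ν (1 - T)) (h₂ : IsPositiveOperator ν (1 + T)) {h f : Lp ℂ 2 ν}
    (hh : ∀ᵐ y ∂ν, 0 ≤ h y) {A : Set Y} (hf : ⇑f =ᵐ[ν] A.indicator h) :
    ⇑(T f) =ᵐ[ν] A.indicator (T h) := by
  have hf_nonneg : ∀ᵐ y ∂ν, 0 ≤ f y := by
    filter_upwards [hh, hf] with y hy hfy
    by_cases hyA : y ∈ A <;> simp [hfy, hyA, hy]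
  have hsub_eq : ∀ᵐ y ∂ν, (h - f) y = Aᶜ.indicator h y := by
    filter_upwards [hf, Lp.coeFn_sub h f] with y hfy hsub
    rw [hsub, Pi.sub_apply, hfy]
    by_cases hyA : y ∈ A <;> simp [hyA]
  have hsub_nonneg : ∀ᵐ y ∂ν, 0 ≤ (h - f) y := by
    filter_upwards [hh, hsub_eq] with y hy hsub
    rw [hsub]
    by_cases hyA : y ∈ A <;> simp [hyA, hy]
  have hT : T (h - f) = T h - T f := map_sub T h f
  filter_upwards [h₁.norm_apply_le h₂ hf_nonneg, h₁.norm_apply_le h₂ hsub_nonneg, hf, hsub_eq,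
    Lp.coeFn_sub (T h) (T f)] with y hy hy' hfy hsub hTsub
  by_cases hyA : y ∈ A
  · rw [hT, hTsub, hsub] at hy'
    simp only [Pi.sub_apply, Set.mem_compl_iff, hyA, not_true_eq_false, not_false_eq_true,
      Set.indicator_of_notMem, Complex.zero_re, norm_le_zero_iff, sub_eq_zero] at hy'
    simp [hyA, hy']
  · simpa [hfy, hyA] using hy

/-- An operator `T` with `-I ≤ T ≤ I` is a multiplication operator. -/
theorem IsPositiveOperator.isMultiplicationOperator [SigmaFinite ν]
    {T : Lp ℂ 2 ν →L[ℂ] Lp ℂ 2 ν} (h₁ : IsPositiveOperator ν (1 - T))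
    (h₂ : IsPositiveOperator ν (1 + T)) : IsMultiplicationOperator ν T := by
  obtain ⟨h, hh⟩ := exists_Lp_two_pos ν
  have hh_nonneg : ∀ᵐ y ∂ν, 0 ≤ h y := hh.mono fun _ hy => hy.le
  have hm : Measurable fun y => T h y / h y :=
    (Lp.stronglyMeasurable (T h)).measurable.div (Lp.stronglyMeasurable h).measurable
  have hbound : ∀ᵐ y ∂ν, ‖T h y / h y‖ ≤ 1 := by
    filter_upwards [h₁.norm_apply_le h₂ hh_nonneg] with y hy
    rw [norm_div]
    exact div_le_one_of_le₀ (hy.trans (Complex.re_le_norm _)) (norm_nonneg _)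
  obtain ⟨S, hS⟩ := exists_clm_coeFn_ae_eq_mul hm hbound
  have hdense := topologicalClosure_span_indicator_eq_top (hh.mono fun _ hy => hy.ne')
  have hTS : T = S := by
    refine ContinuousLinearMap.ext_on (Submodule.dense_iff_topologicalClosure_eq_top.mpr hdense) ?_
    rintro f ⟨A, -, hf⟩
    refine Lp.ext ?_
    filter_upwards [h₁.apply_ae_eq_indicator h₂ hh_nonneg hf, hS f, hf, hh] with y hTy hSy hfy hy
    by_cases hyA : y ∈ A <;> simp [hTy, hSy, hfy, hyA, hy.ne']
  exact ⟨_, hm, ⟨1, hbound⟩, fun f => hTS ▸ hS f⟩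

theorem IsMultiplicationOperator.zero : IsMultiplicationOperator ν 0 := by
  refine ⟨0, measurable_zero, ⟨0, by simp⟩, fun f => ?_⟩
  filter_upwards [Lp.coeFn_zero ℂ 2 ν] with y hy
  simpa using hy

theorem IsMultiplicationOperator.add {S T : Lp ℂ 2 ν →L[ℂ] Lp ℂ 2 ν}
    (hS : IsMultiplicationOperator ν S) (hT : IsMultiplicationOperator ν T) :
    IsMultiplicationOperator ν (S + T) := by
  obtain ⟨m, hm, ⟨M, hM⟩, hSm⟩ := hS
  obtain ⟨k, hk, ⟨K, hK⟩, hTk⟩ := hT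
  refine ⟨m + k, hm.add hk, ⟨M + K, ?_⟩, fun f => ?_⟩
  · filter_upwards [hM, hK] with y hy hy'
    exact norm_add_le_of_le hy hy'
  · filter_upwards [hSm f, hTk f, Lp.coeFn_add (S f) (T f)] with y hy hy' hadd
    exact hadd.trans (by simp [hy, hy', add_mul])

theorem IsMultiplicationOperator.smul {T : Lp ℂ 2 ν →L[ℂ] Lp ℂ 2 ν}
    (hT : IsMultiplicationOperator ν T) (c : ℂ) : IsMultiplicationOperator ν (c • T) := by
  obtain ⟨m, hm, ⟨M, hM⟩, hTm⟩ := hT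
  refine ⟨c • m, hm.const_smul c, ⟨‖c‖ * M, ?_⟩, fun f => ?_⟩
  · filter_upwards [hM] with y hy
    simpa using mul_le_mul_of_nonneg_left hy (norm_nonneg c)
  · filter_upwards [hTm f, Lp.coeFn_smul c (T f)] with y hy hsmul
    simp [hsmul, hy, mul_assoc]

/-- Multiplication by a real function with values in `[-1, 1]` lies between `-I` and `I`. -/
theorem isPositiveOperator_of_mul_real {r : Y → ℝ} (hr : ∀ᵐ y ∂ν, |r y| ≤ 1)
    {T : Lp ℂ 2 ν →L[ℂ] Lp ℂ 2 ν} (hT : ∀ f : Lp ℂ 2 ν, ⇑(T f) =ᵐ[ν] fun y => r y * f y) :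
    IsPositiveOperator ν (1 - T) ∧ IsPositiveOperator ν (1 + T) := by
  refine ⟨fun f hf => ?_, fun f hf => ?_⟩
  · filter_upwards [hf, hr, hT f, Lp.coeFn_sub f (T f)] with y hy hry hTy hsub
    have hnonneg : (0 : ℂ) ≤ ((1 - r y : ℝ) : ℂ) := by
      exact_mod_cast sub_nonneg.mpr (abs_le.mp hry).2
    have heq : ((1 - T) f) y = ((1 - r y : ℝ) : ℂ) * f y :=
      hsub.trans (by simp [hTy, sub_mul])
    exact heq ▸ mul_nonneg hnonneg hy
  · filter_upwards [hf, hr, hT f, Lp.coeFn_add f (T f)] with y hy hry hTy hadd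
    have hnonneg : (0 : ℂ) ≤ ((1 + r y : ℝ) : ℂ) := by
      exact_mod_cast neg_le_iff_add_nonneg'.mp (abs_le.mp hry).1
    have heq : ((1 + T) f) y = ((1 + r y : ℝ) : ℂ) * f y :=
      hadd.trans (by simp [hTy, add_mul])
    exact heq ▸ mul_nonneg hnonneg hy

/-- A bounded real function induces a multiplication operator lying between `-I` and `I` after
division by the bound. -/
theorem exists_isPositiveOperator_mul_div {r : Y → ℝ} (hr : Measurable r) {M : ℝ} (hM_pos : 0 < M)
    (hM : ∀ᵐ y ∂ν, |r y| ≤ M) :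
    ∃ T : Lp ℂ 2 ν →L[ℂ] Lp ℂ 2 ν,
      (IsPositiveOperator ν (1 - T) ∧ IsPositiveOperator ν (1 + T)) ∧
      ∀ f : Lp ℂ 2 ν, ⇑(T f) =ᵐ[ν] fun y => ((r y / M : ℝ) : ℂ) * f y := by
  have hbound : ∀ᵐ y ∂ν, |r y / M| ≤ 1 := by
    filter_upwards [hM] with y hy
    rwa [abs_div, abs_of_pos hM_pos, div_le_one hM_pos]
  have hmeas : Measurable fun y => ((r y / M : ℝ) : ℂ) := by fun_prop
  obtain ⟨T, hT⟩ := exists_clm_coeFn_ae_eq_mul (ν := ν) hmeas (M := 1)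
    (hbound.mono fun y hy => by rwa [Complex.norm_real, Real.norm_eq_abs])
  exact ⟨T, isPositiveOperator_of_mul_real hbound hT, hT⟩

end

/-- `Q` is a multiplication operator iff `Q` is a finite linear combination of
bounded operators `T` such that both `I - T` and `I + T` are positive. -/
theorem multiplication_iff_linear_combination {Y : Type*} [MeasurableSpace Y]
    (ν : Measure Y) [SigmaFinite ν] (Q : Lp ℂ 2 ν →L[ℂ] Lp ℂ 2 ν) :
    IsMultiplicationOperator ν Q ↔
      ∃ (n : ℕ) (c : Fin n → ℂ) (T : Fin n → (Lp ℂ 2 ν →L[ℂ] Lp ℂ 2 ν)),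
        (∀ i, IsPositiveOperator ν (1 - T i) ∧ IsPositiveOperator ν (1 + T i)) ∧
        Q = ∑ i, c i • T i := by
  constructor
  · rintro ⟨m, hm, ⟨M, hM⟩, hQ⟩
    have hK_pos : 0 < max M 1 := lt_max_of_lt_right one_pos
    obtain ⟨R, hR, hR_mul⟩ := exists_isPositiveOperator_mul_div (ν := ν)
      (r := fun y => (m y).re) (by fun_prop) hK_pos
      (hM.mono fun y hy => (Complex.abs_re_le_norm _).trans (hy.trans (le_max_left _ _)))
    obtain ⟨S, hS, hS_mul⟩ := exists_isPositiveOperator_mul_div (ν := ν)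
      (r := fun y => (m y).im) (by fun_prop) hK_pos
      (hM.mono fun y hy => (Complex.abs_im_le_norm _).trans (hy.trans (le_max_left _ _)))
    generalize max M 1 = K at *
    have hK : (K : ℂ) ≠ 0 := by exact_mod_cast hK_pos.ne'
    refine ⟨2, ![(K : ℂ), K * Complex.I], ![R, S], ?_, ?_⟩
    · simp [Fin.forall_fin_two, hR, hS]
    · refine ContinuousLinearMap.ext fun f => Lp.ext ?_
      simp only [Fin.sum_univ_two, Matrix.cons_val_zero, Matrix.cons_val_one,
        add_apply, smul_apply]
      filter_upwards [hQ f, hR_mul f, hS_mul f, Lp.coeFn_smul (K : ℂ) (R f),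
        Lp.coeFn_smul (K * Complex.I) (S f),
        Lp.coeFn_add ((K : ℂ) • R f) ((K * Complex.I) • S f)] with y hQy hRy hSy hKR hKS hadd
      rw [hadd, Pi.add_apply, hKR, hKS, Pi.smul_apply, Pi.smul_apply, hRy, hSy, hQy]
      conv_lhs => rw [← Complex.re_add_im (m y)]
      simp only [smul_eq_mul, Complex.ofReal_div]
      field_simp
  · rintro ⟨n, c, T, hT, rfl⟩
    exact Finset.sum_induction _ (IsMultiplicationOperator ν) (fun _ _ => .add) .zero
      fun i _ => ((hT i).1.isMultiplicationOperator (hT i).2).smul (c i)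
end

section
/- Let (Y,Σ,ν) be a σ-finite measure space and let Q be a bounded linear operator on the complex Hilbert space L²(Y) which is not a multiplication operator. Then there exist a real-valued f ∈ L²(Y) with f ≥ 0 almost everywhere and a measurable set B ⊆ {y ∈ Y : f(y) = 0} such that 0 < ν(B) < ∞ and (Qf, 𝟙_B)_{L²(Y)} = ∫_B (Qf) dν ≠ 0. -/
open MeasureTheory
open scoped ComplexOrder

section AuxiliaryLemmas

variable {Y : Type*} [MeasurableSpace Y] {ν : Measure Y}

/-- The squared norm in `L²` is the integral of the squared pointwise norm. -/
lemma MeasureTheory.L2.norm_sq_eq_integral_norm_sq (f : Lp ℂ 2 ν) :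
    ‖f‖ ^ 2 = ∫ y, ‖f y‖ ^ 2 ∂ν := by
  have h : (((‖f‖ ^ 2 : ℝ)) : ℂ) = ((∫ y, ‖f y‖ ^ 2 ∂ν : ℝ) : ℂ) := by
    rw [← integral_complex_ofReal]
    push_cast
    rw [← Complex.coe_algebraMap, ← inner_self_eq_norm_sq_to_K (𝕜 := ℂ) f, L2.inner_def]
    exact integral_congr_ae (.of_forall fun y => inner_self_eq_norm_sq_to_K (𝕜 := ℂ) (f y))
  exact_mod_cast h

/-- Two `L²` functions ordered pointwise in norm, with global norms in the reverse order, have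
almost everywhere equal norms. -/
lemma MeasureTheory.L2.ae_norm_eq_of_norm_le {f g : Lp ℂ 2 ν}
    (hfg : ∀ᵐ y ∂ν, ‖f y‖ ≤ ‖g y‖) (hgf : ‖g‖ ≤ ‖f‖) : ∀ᵐ y ∂ν, ‖f y‖ = ‖g y‖ := by
  have hi (h : Lp ℂ 2 ν) : Integrable (fun y => ‖h y‖ ^ 2) ν :=
    (memLp_two_iff_integrable_sq_norm (Lp.aestronglyMeasurable h)).1 (Lp.memLp h)
  have hle : ∀ᵐ y ∂ν, ‖f y‖ ^ 2 ≤ ‖g y‖ ^ 2 := by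
    filter_upwards [hfg] with y hy
    gcongr
  have hint : ∫ y, ‖f y‖ ^ 2 ∂ν = ∫ y, ‖g y‖ ^ 2 ∂ν := by
    refine le_antisymm (integral_mono_ae (hi f) (hi g) hle) ?_
    rw [← L2.norm_sq_eq_integral_norm_sq, ← L2.norm_sq_eq_integral_norm_sq]
    gcongr
  filter_upwards [(integral_eq_iff_of_ae_le (hi f) (hi g) hle).1 hint] with y hy
  exact (pow_left_inj₀ (norm_nonneg _) (norm_nonneg _) two_ne_zero).1 hy

/-- A σ-finite measure space carries a strictly positive measurable square-integrable function. -/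
lemma exists_pos_measurable_memLp_two (ν : Measure Y) [SigmaFinite ν] :
    ∃ w : Y → ℝ, (∀ y, 0 < w y) ∧ Measurable w ∧ MemLp (fun y => (w y : ℂ)) 2 ν := by
  obtain ⟨g, hg, hgm, hgi⟩ := exists_pos_lintegral_lt_of_sigmaFinite ν one_ne_zero
  have hwm : Measurable fun y => √(g y : ℝ) := by fun_prop
  refine ⟨fun y => √(g y), fun y => Real.sqrt_pos.2 (hg y), hwm, ?_⟩
  rw [memLp_two_iff_integrable_sq_norm (by fun_prop)]
  have hgi' : Integrable (fun y => (g y : ℝ)) ν :=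
    ⟨by fun_prop, by simpa [HasFiniteIntegral] using hgi.trans ENNReal.one_lt_top⟩
  refine hgi'.congr (.of_forall fun y => ?_)
  simp [abs_of_nonneg (Real.sqrt_nonneg _)]

/-- The truncations of an a.e. nonvanishing `w ∈ L²` to measurable sets span a dense subspace. -/
lemma dense_span_toLp_indicator [SigmaFinite ν] {w : Y → ℂ} (hw : MemLp w 2 ν)
    (hw0 : ∀ y, w y ≠ 0) :
    Dense (Submodule.span ℂ {f : Lp ℂ 2 ν | ∃ (A : Set Y) (hA : MeasurableSet A),
      f = (hw.indicator hA).toLp} : Set (Lp ℂ 2 ν)) := by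
  rw [Submodule.dense_iff_topologicalClosure_eq_top,
    Submodule.topologicalClosure_eq_top_iff, Submodule.eq_bot_iff]
  intro g hg
  have hprod : Integrable (fun y => inner ℂ (hw.toLp w y) (g y)) ν := L2.integrable_inner _ _
  have hzero : (fun y => inner ℂ (hw.toLp w y) (g y)) =ᵐ[ν] 0 := by
    refine ae_eq_zero_of_forall_setIntegral_eq_of_sigmaFinite
      (fun s _ _ => hprod.integrableOn) fun s hs _ => ?_
    have h := (Submodule.mem_orthogonal _ g).1 hg _ (Submodule.subset_span ⟨s, hs, rfl⟩)
    rw [L2.inner_def] at h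
    rw [← h, ← integral_indicator hs]
    refine integral_congr_ae ?_
    filter_upwards [hw.coeFn_toLp, (hw.indicator hs).coeFn_toLp] with y h1 h2
    rw [h2]
    by_cases hy : y ∈ s <;> simp [hy, h1]
  refine (Lp.eq_zero_iff_ae_eq_zero).2 ?_
  filter_upwards [hzero, hw.coeFn_toLp] with y h1 h2
  simpa [h2, hw0 y] using h1

/-- If no admissible test pair detects `Q`, then `Q f` vanishes wherever `f ≥ 0` does. -/
lemma ae_eq_zero_restrict_of_forall_test_pair [SigmaFinite ν] {Q : Lp ℂ 2 ν →L[ℂ] Lp ℂ 2 ν}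
    (hQ : ∀ (f : Lp ℂ 2 ν) (B : Set Y), MeasurableSet B → (∀ᵐ y ∂ν, 0 ≤ f y) →
      B ⊆ {y | f y = 0} → 0 < ν B → ν B < ⊤ → ∫ y in B, Q f y ∂ν = 0)
    {f : Lp ℂ 2 ν} (hf : ∀ᵐ y ∂ν, 0 ≤ f y) {S : Set Y} (hS : MeasurableSet S)
    (hfS : ∀ᵐ y ∂ν, y ∈ S → f y = 0) : ∀ᵐ y ∂ν, y ∈ S → Q f y = 0 := by
  rw [← ae_restrict_iff' hS]
  refine ae_eq_zero_of_forall_setIntegral_eq_of_sigmaFinite (fun s hs hμs => ?_)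
    fun s hs hμs => ?_ <;> rw [Measure.restrict_apply hs] at hμs
  · rw [IntegrableOn, Measure.restrict_restrict hs]
    exact integrableOn_Lp_of_measure_ne_top _ (by norm_num) hμs.ne
  · rw [Measure.restrict_restrict hs]
    have hzm : MeasurableSet {y | f y = 0} :=
      (Lp.stronglyMeasurable f).measurable (measurableSet_singleton 0)
    have hae : (s ∩ S ∩ {y | f y = 0} : Set Y) =ᵐ[ν] (s ∩ S : Set Y) := by
      filter_upwards [hfS] with y hy
      exact propext ⟨fun h => h.1, fun h => ⟨h, hy h.2⟩⟩
    rw [← setIntegral_congr_set hae]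
    rcases eq_or_ne (ν (s ∩ S ∩ {y | f y = 0})) 0 with h0 | h0
    · exact setIntegral_measure_zero _ h0
    · exact hQ f _ ((hs.inter hS).inter hzm) hf Set.inter_subset_right (pos_iff_ne_zero.2 h0)
        (by rwa [measure_congr hae])

/-- If `Q` preserves vanishing of nonnegative functions, it commutes with truncating a
nonnegative function to a measurable set. -/
lemma coeFn_apply_toLp_indicator {Q : Lp ℂ 2 ν →L[ℂ] Lp ℂ 2 ν}
    (hQ : ∀ f : Lp ℂ 2 ν, (∀ᵐ y ∂ν, 0 ≤ f y) → ∀ S : Set Y, MeasurableSet S →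
      (∀ᵐ y ∂ν, y ∈ S → f y = 0) → ∀ᵐ y ∂ν, y ∈ S → Q f y = 0)
    {w : Y → ℂ} (hw : MemLp w 2 ν) (hw0 : ∀ y, 0 ≤ w y) {A : Set Y} (hA : MeasurableSet A) :
    Q (hw.indicator hA).toLp =ᵐ[ν] A.indicator (Q (hw.toLp w)) := by
  have hvanish {S : Set Y} (hS : MeasurableSet S) :
      ∀ᵐ y ∂ν, y ∈ Sᶜ → Q (hw.indicator hS).toLp y = 0 := by
    refine hQ _ ?_ _ hS.compl ?_
    · filter_upwards [(hw.indicator hS).coeFn_toLp] with y hy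
      rw [hy]
      exact Set.indicator_nonneg (fun y _ => hw0 y) y
    · filter_upwards [(hw.indicator hS).coeFn_toLp] with y hy hyS
      rw [hy, Set.indicator_of_notMem hyS]
  have hsum : hw.toLp w = (hw.indicator hA).toLp + (hw.indicator hA.compl).toLp := by
    rw [← MemLp.toLp_add]
    exact MemLp.toLp_congr _ _ (.of_eq (Set.indicator_self_add_compl A w).symm)
  rw [hsum, map_add]
  filter_upwards [hvanish hA, hvanish hA.compl,
    Lp.coeFn_add (Q (hw.indicator hA).toLp) (Q (hw.indicator hA.compl).toLp)] with y h1 h2 h3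
  by_cases hy : y ∈ A
  · rw [Set.indicator_of_mem hy, h3, Pi.add_apply, h2 (not_not.2 hy), add_zero]
  · rw [Set.indicator_of_notMem hy, h1 hy]

/-- An operator that commutes with truncating a nonvanishing `w ∈ L²` to measurable sets is the
multiplication operator by `Q w / w`. -/
lemma isMultiplicationOperator_of_apply_toLp_indicator [SigmaFinite ν]
    {Q : Lp ℂ 2 ν →L[ℂ] Lp ℂ 2 ν} {w : Y → ℂ} (hw : MemLp w 2 ν) (hwm : Measurable w)
    (hw0 : ∀ y, w y ≠ 0)
    (hQ : ∀ (A : Set Y) (hA : MeasurableSet A),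
      Q (hw.indicator hA).toLp =ᵐ[ν] A.indicator (Q (hw.toLp w))) :
    IsMultiplicationOperator ν Q := by
  set m : Y → ℂ := fun y => Q (hw.toLp w) y / w y
  have hm : Measurable m := (Lp.stronglyMeasurable _).measurable.div hwm
  have hQm {A : Set Y} (hA : MeasurableSet A) :
      Q (hw.indicator hA).toLp =ᵐ[ν] fun y => m y * ((hw.indicator hA).toLp _) y := by
    filter_upwards [hQ A hA, (hw.indicator hA).coeFn_toLp] with y h1 h2
    rw [h1, h2]
    by_cases hy : y ∈ A <;> simp [hy, m, div_mul_cancel₀ _ (hw0 y)]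
  have hbound : ∀ᵐ y ∂ν, ‖m y‖ ≤ ‖Q‖ := by
    have hA : MeasurableSet {y | ‖Q‖ < ‖m y‖} := measurableSet_lt measurable_const hm.norm
    set u : Lp ℂ 2 ν := (hw.indicator hA).toLp
    have hu : u =ᵐ[ν] _ := (hw.indicator hA).coeFn_toLp
    have hsmul := Lp.coeFn_smul (‖Q‖ : ℂ) u
    have hle : ∀ᵐ y ∂ν, ‖((‖Q‖ : ℂ) • u) y‖ ≤ ‖Q u y‖ := by
      filter_upwards [hu, hsmul, hQm hA] with y h1 h2 h3
      rw [h2, h3, Pi.smul_apply, smul_eq_mul, norm_mul, norm_mul, h1]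
      by_cases hy : y ∈ {y | ‖Q‖ < ‖m y‖}
      · simpa using mul_le_mul_of_nonneg_right (le_of_lt hy) (norm_nonneg _)
      · simp [Set.indicator_of_notMem hy]
    have hnorm : ‖Q u‖ ≤ ‖(‖Q‖ : ℂ) • u‖ := by
      rw [norm_smul, Complex.norm_real, norm_norm]
      exact Q.le_opNorm u
    filter_upwards [L2.ae_norm_eq_of_norm_le hle hnorm, hu, hsmul, hQm hA] with y h h1 h2 h3
    by_contra! hy
    rw [h2, h3, Pi.smul_apply, smul_eq_mul, norm_mul, norm_mul, h1,
      Set.indicator_of_mem (s := {y | ‖Q‖ < ‖m y‖}) hy] at h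
    exact hy.ne (by simpa using mul_right_cancel₀ (norm_ne_zero_iff.2 (hw0 y)) h)
  have hmtop : MemLp m ⊤ ν := memLp_top_of_bound hm.aestronglyMeasurable _ hbound
  set M : Lp ℂ 2 ν →L[ℂ] Lp ℂ 2 ν :=
    (ContinuousLinearMap.mul ℂ ℂ).holderL ν ⊤ 2 2 (hmtop.toLp m)
  have hM (f : Lp ℂ 2 ν) : M f =ᵐ[ν] fun y => m y * f y := by
    filter_upwards [(ContinuousLinearMap.mul ℂ ℂ).coeFn_holder (r := 2) (hmtop.toLp m) f,
      hmtop.coeFn_toLp] with y h1 h2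
    rw [← h2]
    exact h1
  have hQM : Q = M := by
    refine ContinuousLinearMap.ext_on (dense_span_toLp_indicator hw hw0) ?_
    rintro _ ⟨A, hA, rfl⟩
    exact Lp.ext ((hQm hA).trans (hM _).symm)
  exact ⟨m, hm, ⟨_, hbound⟩, fun f => hQM ▸ hM f⟩

end AuxiliaryLemmas

/-- If `Q` is not a multiplication operator, then there are a real-valued `f ≥ 0`
in `L²(Y)` and a measurable set `B` contained in the zero set of `f` with
`0 < ν B < ∞` and `(Q f, 𝟙_B) = ∫_B Q f dν ≠ 0`. -/
theorem exists_test_pair_of_not_multiplication {Y : Type*} [MeasurableSpace Y]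
    (ν : Measure Y) [SigmaFinite ν] (Q : Lp ℂ 2 ν →L[ℂ] Lp ℂ 2 ν)
    (hQ : ¬ IsMultiplicationOperator ν Q) :
    ∃ (f : Lp ℂ 2 ν) (B : Set Y), MeasurableSet B ∧
      (∀ᵐ y ∂ν, 0 ≤ f y) ∧ B ⊆ {y | f y = 0} ∧
      0 < ν B ∧ ν B < ⊤ ∧ (∫ y in B, Q f y ∂ν) ≠ 0 := by
  by_contra! h
  obtain ⟨w, hw0, hwm, hw⟩ := exists_pos_measurable_memLp_two ν
  exact hQ <| isMultiplicationOperator_of_apply_toLp_indicator hw (by fun_prop)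
    (fun y => Complex.ofReal_ne_zero.2 (hw0 y).ne') fun A hA =>
      coeFn_apply_toLp_indicator
        (fun _ hf _ hS hfS => ae_eq_zero_restrict_of_forall_test_pair h hf hS hfS) hw
        (fun y => Complex.zero_le_real.2 (hw0 y).le) hA
end

section
/- Let d ≥ 1 and let φ, ψ : ℝ^d → ℂ be Lipschitz functions with compact support. Then for all k, l ∈ {1,…,d} one has ∫_{ℝ^d} (∂_k φ)(x) (∂_l ψ)(x) dx = ∫_{ℝ^d} (∂_l φ)(x) (∂_k ψ)(x) dx, where ∂_k φ denotes the almost-everywhere defined partial derivative of φ (which exists a.e. by Rademacher's theorem and is bounded). -/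
open MeasureTheory

/-- The `k`-th partial derivative of `φ : ℝ^d → ℂ`, defined via `fderiv` (for a
Lipschitz function this agrees a.e. with the classical partial derivative, by
Rademacher's theorem, and `fderiv` takes the junk value `0` on the null set of
non-differentiability points). -/
noncomputable def partialDerivC {d : ℕ} (φ : EuclideanSpace ℝ (Fin d) → ℂ) (k : Fin d)
    (x : EuclideanSpace ℝ (Fin d)) : ℂ :=
  fderiv ℝ φ x (EuclideanSpace.single k 1)

open Filter Topology

theorem LipschitzWith.norm_inv_smul_sub_le {E F : Type*} [SeminormedAddCommGroup E]
    [NormedSpace ℝ E] [SeminormedAddCommGroup F] [NormedSpace ℝ F] {C : NNReal} {f : E → F}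
    (hf : LipschitzWith C f) {t : ℝ} (ht : 0 < t) (x v : E) :
    ‖t⁻¹ • (f (x + t • v) - f x)‖ ≤ C * ‖v‖ := by
  calc ‖t⁻¹ • (f (x + t • v) - f x)‖ = t⁻¹ * ‖f (x + t • v) - f x‖ := by
        rw [norm_smul, Real.norm_of_nonneg (by positivity)]
    _ ≤ t⁻¹ * (C * ‖(x + t • v) - x‖) := by gcongr; exact hf.norm_sub_le _ _
    _ = C * ‖v‖ := by
        rw [add_sub_cancel_left, norm_smul, Real.norm_of_nonneg ht.le]
        field_simp

section

variable {E A : Type*} [NormedAddCommGroup E] [MeasurableSpace E] [BorelSpace E] {μ : Measure E}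
  [μ.IsAddHaarMeasure] [NormedRing A] [NormedAlgebra ℝ A]

/-- Discrete version of the symmetry of `(v, w) ↦ ∫ ∂_v f * ∂_w g`: forward differences of `f` are
paired with backward differences of `g`. -/
theorem integral_sub_mul_sub_symm {f g : E → A} (hf : Continuous f) (hg : Continuous g)
    (hfs : HasCompactSupport f) (a b : E) :
    ∫ x, (f (x + a) - f x) * (g (x - b) - g x) ∂μ =
      ∫ x, (f (x + b) - f x) * (g (x - a) - g x) ∂μ := by
  have hint (c d : E) : Integrable (fun x ↦ f (x + c) * g (x - d)) μ :=
    Continuous.integrable_of_hasCompactSupport (by fun_prop)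
      (hfs.comp_homeomorph (Homeomorph.addRight c)).mul_right
  have hshift (c d : E) : ∫ x, f (x + c) * g (x - d) ∂μ = ∫ x, f (x + (c + d)) * g x ∂μ := by
    rw [← integral_add_right_eq_self _ d]
    simp [add_assoc, add_comm d c]
  have expand (c d : E) : ∫ x, (f (x + c) - f x) * (g (x - d) - g x) ∂μ =
      ∫ x, f (x + (c + d)) * g x ∂μ - ∫ x, f (x + c) * g x ∂μ
        - (∫ x, f (x + d) * g x ∂μ - ∫ x, f x * g x ∂μ) := by
    have h1 := hint c d
    have h2 : Integrable (fun x ↦ f (x + c) * g x) μ := by simpa using hint c 0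
    have h3 : Integrable (fun x ↦ f x * g (x - d)) μ := by simpa using hint 0 d
    have h4 : Integrable (fun x ↦ f x * g x) μ := by simpa using hint 0 0
    have h5 : ∫ x, f x * g (x - d) ∂μ = ∫ x, f (x + d) * g x ∂μ := by simpa using hshift 0 d
    simp_rw [sub_mul, mul_sub]
    rw [integral_sub (by exact h1.sub h2) (by exact h3.sub h4), integral_sub h1 h2,
      integral_sub h3 h4, hshift, h5]
  rw [expand, expand, add_comm b a]
  abel

variable [NormedSpace ℝ E] [FiniteDimensional ℝ E] [FiniteDimensional ℝ A]

theorem LipschitzWith.tendsto_integral_inv_smul_sub_mul_inv_smul_sub {C D : NNReal} {f g : E → A}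
    (hf : LipschitzWith C f) (hg : LipschitzWith D g) (hfs : HasCompactSupport f) (v w : E) :
    Tendsto (fun t : ℝ ↦ ∫ x, (t⁻¹ • (f (x + t • v) - f x)) * (t⁻¹ • (g (x + t • w) - g x)) ∂μ)
      (𝓝[>] 0) (𝓝 (∫ x, fderiv ℝ f x v * fderiv ℝ g x w ∂μ)) := by
  have hfc := hf.continuous
  have hgc := hg.continuous
  let K := Metric.cthickening ‖v‖ (tsupport f)
  have hK : IsCompact K := IsCompact.cthickening hfs
  apply tendsto_integral_filter_of_dominated_convergence
    (K.indicator fun _ ↦ (C * ‖v‖) * (D * ‖w‖))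
  · exact .of_forall fun t ↦ Continuous.aestronglyMeasurable (by fun_prop)
  · filter_upwards [Ioc_mem_nhdsGT zero_lt_one] with t ht
    refine .of_forall fun x ↦ ?_
    by_cases hx : x ∈ K
    · rw [Set.indicator_of_mem hx]
      exact (norm_mul_le _ _).trans (mul_le_mul (hf.norm_inv_smul_sub_le ht.1 x v)
        (hg.norm_inv_smul_sub_le ht.1 x w) (norm_nonneg _) (by positivity))
    · have h1 : f x = 0 := by
        contrapose! hx
        exact Metric.self_subset_cthickening _ (subset_tsupport _ hx)
      have h2 : f (x + t • v) = 0 := by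
        contrapose! hx
        apply Metric.mem_cthickening_of_dist_le _ _ _ _ (subset_tsupport _ hx)
        rw [dist_self_add_right, norm_smul, Real.norm_of_nonneg ht.1.le]
        exact mul_le_of_le_one_left (norm_nonneg v) ht.2
      simp [h1, h2, hx]
  · rw [integrable_indicator_iff hK.measurableSet]
    exact integrableOn_const hK.measure_lt_top.ne
  · filter_upwards [hf.ae_differentiableAt (μ := μ), hg.ae_differentiableAt (μ := μ)] with x h1 h2
    exact (h1.hasFDerivAt.hasLineDerivAt v).tendsto_slope_zero_right.mul
      (h2.hasFDerivAt.hasLineDerivAt w).tendsto_slope_zero_right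

theorem LipschitzWith.integral_fderiv_mul_fderiv_symm {C D : NNReal} {f g : E → A}
    (hf : LipschitzWith C f) (hg : LipschitzWith D g) (hfs : HasCompactSupport f) (v w : E) :
    ∫ x, fderiv ℝ f x v * fderiv ℝ g x w ∂μ = ∫ x, fderiv ℝ f x w * fderiv ℝ g x v ∂μ := by
  have key : ∫ x, fderiv ℝ f x v * fderiv ℝ g x (-w) ∂μ =
      ∫ x, fderiv ℝ f x w * fderiv ℝ g x (-v) ∂μ := by
    refine tendsto_nhds_unique
      (hf.tendsto_integral_inv_smul_sub_mul_inv_smul_sub hg hfs v (-w) (μ := μ)) ?_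
    convert hf.tendsto_integral_inv_smul_sub_mul_inv_smul_sub hg hfs w (-v) (μ := μ) using 2 with t
    simp_rw [smul_mul_smul_comm, integral_smul, smul_neg, ← sub_eq_add_neg]
    rw [integral_sub_mul_sub_symm hf.continuous hg.continuous hfs]
  simpa [integral_neg] using key

end

/-- For Lipschitz compactly supported `φ, ψ : ℝ^d → ℂ` one has
`∫ ∂_k φ · ∂_l ψ = ∫ ∂_l φ · ∂_k ψ`. -/
theorem integral_partialDeriv_symm {d : ℕ} (hd : 1 ≤ d)
    (φ ψ : EuclideanSpace ℝ (Fin d) → ℂ) (Kφ Kψ : NNReal)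
    (hφ : LipschitzWith Kφ φ) (hψ : LipschitzWith Kψ ψ)
    (hφs : HasCompactSupport φ) (hψs : HasCompactSupport ψ) (k l : Fin d) :
    ∫ x, partialDerivC φ k x * partialDerivC ψ l x =
      ∫ x, partialDerivC φ l x * partialDerivC ψ k x := by
  exact hφ.integral_fderiv_mul_fderiv_symm hψ hφs _ _
end

section
/- Let d ≥ 1, τ ∈ ℝ and k̃, l̃ ∈ {1,…,d}. Then there exist Lipschitz functions φ, ψ : ℝ^d → ℝ with φ ≥ 0, ψ ≥ 0 and support contained in [−1,1]^d such that ∫_{ℝ^d} (∂_{l̃} φ)(∂_{k̃} ψ) = ∫_{ℝ^d} (∂_{k̃} φ)(∂_{l̃} ψ) = τ and ∫_{ℝ^d} (∂_l φ)(∂_k ψ) = 0 for all k, l ∈ {1,…,d} with (k,l) ∉ {(k̃,l̃), (l̃,k̃)}. -/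
open MeasureTheory

/-- The `k`-th partial derivative of `φ : ℝ^d → ℝ`, defined via `fderiv` (for a
Lipschitz function this agrees a.e. with the classical partial derivative, by
Rademacher's theorem, and `fderiv` takes the junk value `0` on the null set of
non-differentiability points). -/
noncomputable def partialDerivR {d : ℕ} (φ : EuclideanSpace ℝ (Fin d) → ℝ) (k : Fin d)
    (x : EuclideanSpace ℝ (Fin d)) : ℝ :=
  fderiv ℝ φ x (EuclideanSpace.single k 1)

theorem hasDerivAt_max_zero_sq (t : ℝ) :
    HasDerivAt (fun t : ℝ => max t 0 ^ 2) (2 * max t 0) t := by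
  rcases lt_trichotomy t 0 with h | rfl | h
  · rw [max_eq_right h.le, mul_zero]
    refine (hasDerivAt_const t (0 : ℝ)).congr_of_eventuallyEq ?_
    filter_upwards [eventually_lt_nhds h] with s hs
    simp [max_eq_right hs.le]
  · have h2 : HasDerivAt (fun t : ℝ => t ^ 2) 0 0 := by simpa using hasDerivAt_pow 2 (0 : ℝ)
    rw [hasDerivAt_iff_isLittleO] at h2 ⊢
    simp only [max_self, mul_zero, smul_zero, sub_zero, ne_eq, OfNat.ofNat_ne_zero,
      not_false_eq_true, zero_pow] at h2 ⊢
    refine (Asymptotics.isBigO_of_le _ fun s => ?_).trans_isLittleO h2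
    rw [norm_pow, norm_pow]
    gcongr
    rcases le_total s 0 with hs | hs <;> simp [hs]
  · rw [max_eq_left h.le]
    have h2 : HasDerivAt (fun t : ℝ => t ^ 2) (2 * t) t := by simpa using hasDerivAt_pow 2 t
    refine h2.congr_of_eventuallyEq ?_
    filter_upwards [eventually_gt_nhds h] with s hs
    simp [max_eq_left hs.le]

/-- The truncated polynomial `(1 - x²)₊² (a + b x² + c x³ + e x⁴)`. -/
noncomputable def truncPoly (a b c e x : ℝ) : ℝ :=
  max (1 - x ^ 2) 0 ^ 2 * (a + b * x ^ 2 + c * x ^ 3 + e * x ^ 4)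

theorem hasDerivAt_truncPoly (a b c e x : ℝ) :
    HasDerivAt (truncPoly a b c e)
      (2 * max (1 - x ^ 2) 0 * (-(2 * x)) * (a + b * x ^ 2 + c * x ^ 3 + e * x ^ 4) +
        max (1 - x ^ 2) 0 ^ 2 * (b * (2 * x) + c * (3 * x ^ 2) + e * (4 * x ^ 3))) x := by
  have h1 : HasDerivAt (fun x : ℝ => 1 - x ^ 2) (-(2 * x)) x := by
    simpa using (hasDerivAt_pow 2 x).const_sub 1
  have h2 : HasDerivAt (fun x : ℝ => a + b * x ^ 2 + c * x ^ 3 + e * x ^ 4)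
      (b * (2 * x) + c * (3 * x ^ 2) + e * (4 * x ^ 3)) x := by
    simpa using! ((((hasDerivAt_pow 2 x).const_mul b).const_add a).add
      ((hasDerivAt_pow 3 x).const_mul c)).add ((hasDerivAt_pow 4 x).const_mul e)
  exact ((hasDerivAt_max_zero_sq (1 - x ^ 2)).comp x h1).mul h2

theorem deriv_truncPoly (a b c e : ℝ) :
    deriv (truncPoly a b c e) = fun x =>
      2 * max (1 - x ^ 2) 0 * (-(2 * x)) * (a + b * x ^ 2 + c * x ^ 3 + e * x ^ 4) +
        max (1 - x ^ 2) 0 ^ 2 * (b * (2 * x) + c * (3 * x ^ 2) + e * (4 * x ^ 3)) :=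
  funext fun x => (hasDerivAt_truncPoly a b c e x).deriv

theorem contDiff_truncPoly (a b c e : ℝ) : ContDiff ℝ 1 (truncPoly a b c e) := by
  refine contDiff_one_iff_deriv.2 ⟨fun x => (hasDerivAt_truncPoly a b c e x).differentiableAt, ?_⟩
  rw [deriv_truncPoly]
  fun_prop

theorem abs_le_one_of_truncPoly_ne_zero {a b c e x : ℝ} (h : truncPoly a b c e x ≠ 0) :
    |x| ≤ 1 := by
  contrapose! h
  have : 1 < x ^ 2 := (one_lt_sq_iff_one_lt_abs x).2 h
  simp [truncPoly, max_eq_right (by linarith : 1 - x ^ 2 ≤ 0)]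

theorem truncPoly_nonneg {a b c e : ℝ} (ha : 0 ≤ a) (hc : |c| ≤ b) (he : 0 ≤ e) (x : ℝ) :
    0 ≤ truncPoly a b c e x := by
  by_cases h : truncPoly a b c e x = 0
  · exact h.ge
  have hx := abs_le_one_of_truncPoly_ne_zero h
  have h1 : |c * x| ≤ b := by
    rw [abs_mul]
    exact (mul_le_of_le_one_right (abs_nonneg c) hx).trans hc
  have h2 : 0 ≤ x ^ 2 * (b + c * x) := mul_nonneg (sq_nonneg x) (by linarith [neg_abs_le (c * x)])
  have h3 : 0 ≤ e * x ^ 4 := by positivity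
  exact mul_nonneg (sq_nonneg _) (by linarith)

theorem integral_sum_mul_pow {n : ℕ} (c : Fin n → ℝ) :
    ∫ x in (-1 : ℝ)..1, ∑ i, c i * x ^ (i : ℕ) =
      ∑ i, c i * ((1 - (-1) ^ ((i : ℕ) + 1)) / ((i : ℕ) + 1)) := by
  rw [intervalIntegral.integral_finsetSum]
  · simp
  · exact fun i _ => Continuous.intervalIntegrable (by fun_prop) _ _

theorem integral_eq_sum_of_eq_of_max {n : ℕ} {F : ℝ → ℝ} (c : Fin n → ℝ) (G : ℝ → ℝ → ℝ)
    (hF : ∀ x, F x = G x (max (1 - x ^ 2) 0)) (h0 : ∀ x, G x 0 = 0)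
    (hG : ∀ x, G x (1 - x ^ 2) = ∑ i, c i * x ^ (i : ℕ)) :
    ∫ x, F x = ∑ i, c i * ((1 - (-1) ^ ((i : ℕ) + 1)) / ((i : ℕ) + 1)) := by
  rw [← integral_sum_mul_pow, intervalIntegral.integral_of_le (by norm_num),
    ← integral_Icc_eq_integral_Ioc, ← setIntegral_eq_integral_of_forall_compl_eq_zero
      (s := Set.Icc (-1) 1)]
  · refine setIntegral_congr_fun measurableSet_Icc fun x hx => ?_
    rw [hF, ← hG, max_eq_left]
    nlinarith [hx.1, hx.2]
  · intro x hx
    have h : 1 < |x| := not_le.1 fun h => hx (abs_le.1 h)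
    have h1 : 1 < x ^ 2 := (one_lt_sq_iff_one_lt_abs x).2 h
    rw [hF, max_eq_right (by linarith), h0]

theorem integral_truncPoly_mul (b c : ℝ) :
    ∫ x, truncPoly 1 0 0 0 x * truncPoly 0 b c 0 x = 256 / 3465 * b := by
  rw [integral_eq_sum_of_eq_of_max ![0, 0, b, c, -4 * b, -4 * c, 6 * b, 6 * c, -4 * b, -4 * c, b, c]
    (fun x m => m ^ 2 * (m ^ 2 * (b * x ^ 2 + c * x ^ 3)))]
  · simp [Fin.sum_univ_succ]; ring
  · intro x; simp [truncPoly]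
  · intro x; simp
  · intro x; simp [Fin.sum_univ_succ]; ring

theorem integral_deriv_truncPoly_mul (a b c e : ℝ) :
    ∫ x, deriv (truncPoly 1 0 0 0) x * truncPoly a b c e x = -(128 / 1155) * c := by
  rw [deriv_truncPoly, integral_eq_sum_of_eq_of_max
    ![0, -4 * a, 0, 12 * a - 4 * b, -4 * c, -12 * a + 12 * b - 4 * e, 12 * c,
      4 * a - 12 * b + 12 * e, -12 * c, 4 * b - 12 * e, 4 * c, 4 * e]
    (fun x m => m * (-(4 * x)) * (m ^ 2 * (a + b * x ^ 2 + c * x ^ 3 + e * x ^ 4)))]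
  · simp [Fin.sum_univ_succ]; ring
  · intro x; simp only [truncPoly]; ring
  · intro x; simp
  · intro x; simp [Fin.sum_univ_succ]; ring

theorem integral_truncPoly_mul_deriv (a b c e : ℝ) :
    ∫ x, truncPoly 1 0 0 0 x * deriv (truncPoly a b c e) x = 128 / 1155 * c := by
  rw [deriv_truncPoly, integral_eq_sum_of_eq_of_max
    ![0, 2 * b - 4 * a, 3 * c, 4 * e - 12 * b + 12 * a, -16 * c, 24 * b - 20 * e - 12 * a, 30 * c,
      36 * e - 20 * b + 4 * a, -24 * c, 6 * b - 28 * e, 7 * c, 8 * e]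
    (fun x m => m ^ 2 * (2 * m * (-(2 * x)) * (a + b * x ^ 2 + c * x ^ 3 + e * x ^ 4) +
      m ^ 2 * (b * (2 * x) + c * (3 * x ^ 2) + e * (4 * x ^ 3))))]
  · simp [Fin.sum_univ_succ]; ring
  · intro x; simp only [truncPoly]; ring
  · intro x; simp
  · intro x; simp [Fin.sum_univ_succ]; ring

theorem integral_deriv_truncPoly_mul_deriv (a b c e : ℝ) :
    ∫ x, deriv (truncPoly 1 0 0 0) x * deriv (truncPoly a b c e) x =
      256 / 105 * a - 256 / 3465 * e := by
  rw [deriv_truncPoly, deriv_truncPoly, integral_eq_sum_of_eq_of_max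
    ![0, 0, 16 * a - 8 * b, -12 * c, 40 * b - 16 * e - 32 * a, 52 * c, 64 * e - 56 * b + 16 * a,
      -68 * c, 24 * b - 80 * e, 28 * c, 32 * e]
    (fun x m => m * (-(4 * x)) * (2 * m * (-(2 * x)) * (a + b * x ^ 2 + c * x ^ 3 + e * x ^ 4) +
      m ^ 2 * (b * (2 * x) + c * (3 * x ^ 2) + e * (4 * x ^ 3))))]
  · simp [Fin.sum_univ_succ]; ring
  · intro x; simp only; ring
  · intro x; simp
  · intro x; simp [Fin.sum_univ_succ]; ring

/-- A pair of nonnegative `C¹` bumps on the line with prescribed pairings `p` of the derivatives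
and `q` of the derivative of the first with the second; for `p = q = 0` the bumps themselves
pair to `1`. -/
theorem exists_bump_pair (p q : ℝ) :
    ∃ f g : ℝ → ℝ, (ContDiff ℝ 1 f ∧ (∀ x, 0 ≤ f x) ∧ ∀ x, f x ≠ 0 → |x| ≤ 1) ∧
      (ContDiff ℝ 1 g ∧ (∀ x, 0 ≤ g x) ∧ ∀ x, g x ≠ 0 → |x| ≤ 1) ∧
      ∫ x, deriv f x * deriv g x = p ∧ ∫ x, deriv f x * g x = q ∧ ∫ x, f x * deriv g x = -q ∧
      (p = 0 → q = 0 → ∫ x, f x * g x = 1) := by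
  have hf : ContDiff ℝ 1 (truncPoly 1 0 0 0) ∧ (∀ x, 0 ≤ truncPoly 1 0 0 0 x) ∧
      ∀ x, truncPoly 1 0 0 0 x ≠ 0 → |x| ≤ 1 :=
    ⟨contDiff_truncPoly _ _ _ _, truncPoly_nonneg (by simp) (by simp) le_rfl,
      fun x => abs_le_one_of_truncPoly_ne_zero⟩
  by_cases h : p = 0 ∧ q = 0
  · obtain ⟨rfl, rfl⟩ := h
    refine ⟨truncPoly 1 0 0 0, truncPoly 0 (3465 / 256) 0 0, hf, ⟨contDiff_truncPoly _ _ _ _,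
      truncPoly_nonneg le_rfl (by norm_num) le_rfl, fun x => abs_le_one_of_truncPoly_ne_zero⟩,
      ?_, ?_, ?_, fun _ _ => ?_⟩
    · rw [integral_deriv_truncPoly_mul_deriv]; norm_num
    · rw [integral_deriv_truncPoly_mul]; norm_num
    · rw [integral_truncPoly_mul_deriv]; norm_num
    · rw [integral_truncPoly_mul]; norm_num
  · refine ⟨truncPoly 1 0 0 0, truncPoly (105 / 256 * max p 0) |-(1155 / 128 * q)|
      (-(1155 / 128 * q)) (3465 / 256 * max (-p) 0), hf, ⟨contDiff_truncPoly _ _ _ _,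
      truncPoly_nonneg (by positivity) le_rfl (by positivity),
      fun x => abs_le_one_of_truncPoly_ne_zero⟩, ?_, ?_, ?_, fun hp hq => absurd ⟨hp, hq⟩ h⟩
    · rw [integral_deriv_truncPoly_mul_deriv]
      rcases le_total p 0 with hp | hp <;> simp [hp] <;> ring
    · rw [integral_deriv_truncPoly_mul]; ring
    · rw [integral_truncPoly_mul_deriv]; ring

section TensorProduct

variable {d : ℕ}

/-- The tensor product `x ↦ ∏ i, f i (x i)` of functions of one variable. -/
def tensorProd (f : Fin d → ℝ → ℝ) (x : EuclideanSpace ℝ (Fin d)) : ℝ :=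
  ∏ i, f i (x i)

theorem tensorProd_nonneg {f : Fin d → ℝ → ℝ} (hf : ∀ i x, 0 ≤ f i x)
    (x : EuclideanSpace ℝ (Fin d)) : 0 ≤ tensorProd f x :=
  Finset.prod_nonneg fun i _ => hf i (x i)

theorem support_tensorProd_subset {f : Fin d → ℝ → ℝ} (hf : ∀ i x, f i x ≠ 0 → |x| ≤ 1) :
    Function.support (tensorProd f) ⊆ {x | ∀ i, |x i| ≤ 1} :=
  fun x hx i => hf i (x i) (Finset.prod_ne_zero_iff.1 hx i (Finset.mem_univ i))

theorem contDiff_tensorProd {f : Fin d → ℝ → ℝ} (hf : ∀ i, ContDiff ℝ 1 (f i)) :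
    ContDiff ℝ 1 (tensorProd f) := by
  unfold tensorProd
  fun_prop

theorem exists_lipschitzWith_tensorProd {f : Fin d → ℝ → ℝ} (hf : ∀ i, ContDiff ℝ 1 (f i))
    (hf' : ∀ i x, f i x ≠ 0 → |x| ≤ 1) : ∃ K, LipschitzWith K (tensorProd f) := by
  refine ContDiff.lipschitzWith_of_hasCompactSupport (𝕂 := ℝ) (n := 1) ?_
    (contDiff_tensorProd hf) one_ne_zero
  have hK : IsCompact ((EuclideanSpace.equiv (Fin d) ℝ).toHomeomorph ⁻¹'
      Set.univ.pi fun _ => Set.Icc (-1) 1) :=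
    (Homeomorph.isCompact_preimage _).2 (isCompact_univ_pi fun _ => isCompact_Icc)
  refine HasCompactSupport.of_support_subset_isCompact hK fun x hx i _ => ?_
  exact abs_le.1 (support_tensorProd_subset hf' hx i)

theorem partialDerivR_tensorProd {f : Fin d → ℝ → ℝ} (hf : ∀ i, Differentiable ℝ (f i))
    (k : Fin d) :
    partialDerivR (tensorProd f) k = tensorProd (Function.update f k (deriv (f k))) := by
  ext x
  have h : HasFDerivAt (tensorProd f) _ x := HasFDerivAt.finsetProd (u := Finset.univ)
    (g := fun i (x : EuclideanSpace ℝ (Fin d)) => f i (x i)) fun i _ =>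
      ((hf i (x i)).hasDerivAt.comp_hasFDerivAt x (EuclideanSpace.proj (𝕜 := ℝ) i).hasFDerivAt)
  rw [partialDerivR, h.fderiv, tensorProd, ← Finset.mul_prod_erase _ _ (Finset.mem_univ k)]
  rw [sum_apply, Finset.sum_eq_single k]
  · have h' : ∀ i ∈ Finset.univ.erase k,
        Function.update f k (deriv (f k)) i (x i) = f i (x i) := fun i hi => by
      rw [Function.update_of_ne (Finset.ne_of_mem_erase hi)]
    rw [Finset.prod_congr rfl h']
    simp [mul_comm]
  · intro i _ hi
    simp [hi]
  · simp

theorem integral_tensorProd_mul (f g : Fin d → ℝ → ℝ) :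
    ∫ x, tensorProd f x * tensorProd g x = ∏ i, ∫ t, f i t * g i t := by
  rw [← integral_fintype_prod_volume_eq_prod fun i t => f i t * g i t,
    ← (PiLp.volume_preserving_ofLp (Fin d)).integral_comp
      (MeasurableEquiv.toLp 2 (Fin d → ℝ)).symm.measurableEmbedding]
  simp only [tensorProd, Finset.prod_mul_distrib]

theorem integral_partialDerivR_tensorProd {f g : Fin d → ℝ → ℝ} {p q : Fin d → ℝ}
    (hf : ∀ i, ContDiff ℝ 1 (f i)) (hg : ∀ i, ContDiff ℝ 1 (g i))
    (h11 : ∀ i, ∫ x, deriv (f i) x * deriv (g i) x = p i)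
    (h10 : ∀ i, ∫ x, deriv (f i) x * g i x = q i)
    (h01 : ∀ i, ∫ x, f i x * deriv (g i) x = -q i) (l k : Fin d) :
    ∫ x, partialDerivR (tensorProd f) l x * partialDerivR (tensorProd g) k x =
      ∏ i, if i = l then (if i = k then p i else q i) else
        (if i = k then -q i else ∫ x, f i x * g i x) := by
  rw [partialDerivR_tensorProd fun i => (hf i).differentiable one_ne_zero,
    partialDerivR_tensorProd fun i => (hg i).differentiable one_ne_zero, integral_tensorProd_mul]
  refine Finset.prod_congr rfl fun i _ => ?_
  split_ifs with hl hk hk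
  · subst hl hk; simpa using h11 i
  · subst hl; simpa [hk] using h10 i
  · subst hk; simpa [hl] using h01 i
  · simp [hl, hk]

/-- Nonnegative Lipschitz tensor products whose gradient pairings factor through prescribed
one-dimensional pairings. -/
theorem exists_tensorProd (p q : Fin d → ℝ) :
    ∃ (φ ψ : EuclideanSpace ℝ (Fin d) → ℝ) (Kφ Kψ : NNReal) (r : Fin d → ℝ),
      LipschitzWith Kφ φ ∧ LipschitzWith Kψ ψ ∧
      (∀ x, 0 ≤ φ x) ∧ (∀ x, 0 ≤ ψ x) ∧
      (Function.support φ ⊆ {x | ∀ i, |x i| ≤ 1}) ∧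
      (Function.support ψ ⊆ {x | ∀ i, |x i| ≤ 1}) ∧
      (∀ i, p i = 0 → q i = 0 → r i = 1) ∧
      ∀ l k, ∫ x, partialDerivR φ l x * partialDerivR ψ k x =
        ∏ i, if i = l then (if i = k then p i else q i) else (if i = k then -q i else r i) := by
  choose f g hf hg h11 h10 h01 h00 using fun i => exists_bump_pair (p i) (q i)
  obtain ⟨Kφ, hφ⟩ := exists_lipschitzWith_tensorProd (fun i => (hf i).1) fun i => (hf i).2.2
  obtain ⟨Kψ, hψ⟩ := exists_lipschitzWith_tensorProd (fun i => (hg i).1) fun i => (hg i).2.2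
  exact ⟨tensorProd f, tensorProd g, Kφ, Kψ, fun i => ∫ x, f i x * g i x, hφ, hψ,
    tensorProd_nonneg fun i => (hf i).2.1, tensorProd_nonneg fun i => (hg i).2.1,
    support_tensorProd_subset fun i => (hf i).2.2, support_tensorProd_subset fun i => (hg i).2.2,
    h00, integral_partialDerivR_tensorProd (fun i => (hf i).1) (fun i => (hg i).1) h11 h10 h01⟩

end TensorProduct

/-- Construction of nonnegative Lipschitz test functions supported in `[-1,1]^d`
whose gradients pair to a prescribed value `τ` in the `(k̃,l̃)` slots and to `0`
in all other slots. -/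
theorem exists_test_functions {d : ℕ} (hd : 1 ≤ d) (τ : ℝ) (k' l' : Fin d) :
    ∃ (φ ψ : EuclideanSpace ℝ (Fin d) → ℝ) (Kφ Kψ : NNReal),
      LipschitzWith Kφ φ ∧ LipschitzWith Kψ ψ ∧
      (∀ x, 0 ≤ φ x) ∧ (∀ x, 0 ≤ ψ x) ∧
      (Function.support φ ⊆ {x | ∀ i, |x i| ≤ 1}) ∧
      (Function.support ψ ⊆ {x | ∀ i, |x i| ≤ 1}) ∧
      (∫ x, partialDerivR φ l' x * partialDerivR ψ k' x = τ) ∧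
      (∫ x, partialDerivR φ k' x * partialDerivR ψ l' x = τ) ∧
      ∀ k l : Fin d, (k, l) ≠ (k', l') → (k, l) ≠ (l', k') →
        ∫ x, partialDerivR φ l x * partialDerivR ψ k x = 0 := by
  obtain rfl | hkl := eq_or_ne k' l'
  · obtain ⟨φ, ψ, Kφ, Kψ, r, h1, h2, h3, h4, h5, h6, hr, h⟩ :=
      exists_tensorProd (Pi.single k' τ) 0
    have key : ∫ x, partialDerivR φ k' x * partialDerivR ψ k' x = τ := by
      rw [h, Finset.prod_eq_single k']
      · simp
      · intro i _ hi
        simp [hi, hr]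
      · simp
    refine ⟨φ, ψ, Kφ, Kψ, h1, h2, h3, h4, h5, h6, key, key, fun k l hkl _ => ?_⟩
    rw [h, Finset.prod_eq_zero (Finset.mem_univ l)]
    obtain rfl | hne := eq_or_ne l k
    · have : l ≠ k' := by rintro rfl; exact hkl rfl
      simp [this]
    · simp [hne]
  · obtain ⟨φ, ψ, Kφ, Kψ, r, h1, h2, h3, h4, h5, h6, hr, h⟩ :=
      exists_tensorProd 0 (fun i => if i = k' then τ else if i = l' then -1 else 0)
    refine ⟨φ, ψ, Kφ, Kψ, h1, h2, h3, h4, h5, h6, ?_, ?_, fun k l hne1 hne2 => ?_⟩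
    · rw [h, Finset.prod_eq_mul k' l' hkl]
      · simp [hkl, hkl.symm]
      · rintro i _ ⟨hi, hi'⟩
        simp [hi, hi', hr]
      · simp
      · simp
    · rw [h, Finset.prod_eq_mul k' l' hkl]
      · simp [hkl, hkl.symm]
      · rintro i _ ⟨hi, hi'⟩
        simp [hi, hi', hr]
      · simp
      · simp
    · rw [h]
      obtain rfl | hne := eq_or_ne l k
      · exact Finset.prod_eq_zero (Finset.mem_univ l) (by simp)
      by_cases hl : l = k' ∨ l = l'
      · have hk : k ≠ k' ∧ k ≠ l' := by grind
        exact Finset.prod_eq_zero (Finset.mem_univ k) (by simp [hne.symm, hk])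
      · push Not at hl
        exact Finset.prod_eq_zero (Finset.mem_univ l) (by simp [hne, hl])
end

section
/- Let Ω = (−1,1)³ ⊆ ℝ³. Define c_kl : Ω → ℝ for k, l ∈ {1,2,3} by c_12(x) = −(x₁²−1)(x₂²−1)x₃, c_23(x) = −(x₂²−1)(x₃²−1)x₁, c_13(x) = (x₁²−1)(x₃²−1)x₂, c_11 = c_22 = c_33 = 0, c_21 = −c_12, c_32 = −c_23, c_31 = −c_13. Then for all smooth functions φ, ψ : ℝ³ → ℂ one has Σ_{k,l=1}^3 ∫_Ω c_kl(x) (∂_l φ)(x) conj((∂_k ψ)(x)) dx = 0. -/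
open MeasureTheory

/-- The `k`-th partial derivative via `fderiv`. -/
noncomputable def partialDerivC3 (φ : EuclideanSpace ℝ (Fin 3) → ℂ) (k : Fin 3)
    (x : EuclideanSpace ℝ (Fin 3)) : ℂ :=
  fderiv ℝ φ x (EuclideanSpace.single k 1)

/-- The antisymmetric coefficients `c_kl` on `Ω = (-1,1)³` (indices shifted to `0,1,2`):
`c₁₂(x) = -(x₁²-1)(x₂²-1)x₃`, `c₂₃(x) = -(x₂²-1)(x₃²-1)x₁`, `c₁₃(x) = (x₁²-1)(x₃²-1)x₂`,
`c₁₁ = c₂₂ = c₃₃ = 0`, `c₂₁ = -c₁₂`, `c₃₂ = -c₂₃`, `c₃₁ = -c₁₃`. -/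
noncomputable def exampleCoeff (k l : Fin 3) (x : EuclideanSpace ℝ (Fin 3)) : ℝ :=
  !![0, -(x 0 ^ 2 - 1) * (x 1 ^ 2 - 1) * x 2, (x 0 ^ 2 - 1) * (x 2 ^ 2 - 1) * x 1;
     (x 0 ^ 2 - 1) * (x 1 ^ 2 - 1) * x 2, 0, -(x 1 ^ 2 - 1) * (x 2 ^ 2 - 1) * x 0;
     -(x 0 ^ 2 - 1) * (x 2 ^ 2 - 1) * x 1, (x 1 ^ 2 - 1) * (x 2 ^ 2 - 1) * x 0, 0] k l

/-- A continuous function is integrable on the open cube `(-1,1)ⁿ`. -/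
theorem Continuous.integrableOn_openCube {n : ℕ} {f : EuclideanSpace ℝ (Fin n) → ℂ}
    (hf : Continuous f) :
    IntegrableOn f {x : EuclideanSpace ℝ (Fin n) | ∀ i, x i ∈ Set.Ioo (-1 : ℝ) 1} := by
  have hK : IsCompact (WithLp.toLp 2 '' Set.Icc (fun _ : Fin n => (-1 : ℝ)) (fun _ => 1)) :=
    isCompact_Icc.image (PiLp.continuous_toLp 2 _)
  refine (hf.continuousOn.integrableOn_compact hK).mono_set fun x hx => ?_
  exact ⟨WithLp.ofLp x, ⟨fun i => (hx i).1.le, fun i => (hx i).2.le⟩, rfl⟩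

/-- The divergence theorem on the cube `(-1,1)ⁿ⁺¹` for a `C¹` field whose normal component vanishes
on every face. -/
theorem integral_openCube_divergence_eq_zero {n : ℕ}
    (F : Fin (n + 1) → EuclideanSpace ℝ (Fin (n + 1)) → ℂ) (hF : ∀ k, ContDiff ℝ 1 (F k))
    (hF₀ : ∀ k x, x k ^ 2 = 1 → F k x = 0) :
    ∫ x in {x : EuclideanSpace ℝ (Fin (n + 1)) | ∀ i, x i ∈ Set.Ioo (-1 : ℝ) 1},
      ∑ k, fderiv ℝ (F k) x (EuclideanSpace.single k 1) = 0 := by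
  let L : (Fin (n + 1) → ℝ) →L[ℝ] EuclideanSpace ℝ (Fin (n + 1)) :=
    ((EuclideanSpace.equiv (Fin (n + 1)) ℝ).symm : _ →L[ℝ] _)
  have hL : ∀ x, L x = WithLp.toLp 2 x := fun _ => rfl
  have hcont : ∀ k, Continuous (fun x => fderiv ℝ (F k) (L x)) := fun k =>
    ((hF k).continuous_fderiv one_ne_zero).comp L.continuous
  have hdiv := integral_divergence_of_hasFDerivAt_off_countable' (E := ℂ)
    (fun _ : Fin (n + 1) => (-1 : ℝ)) (fun _ => 1) (fun _ => by norm_num)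
    (fun k x => F k (L x)) (fun k x => (fderiv ℝ (F k) (L x)).comp L) ∅ Set.countable_empty
    (fun k => ((hF k).continuous.comp L.continuous).continuousOn)
    (fun x _ k =>
      (((hF k).differentiable one_ne_zero) (L x)).hasFDerivAt.comp x L.hasFDerivAt)
    (Continuous.continuousOn (continuous_finsetSum _ fun k _ =>
      (hcont k).clm_apply continuous_const) |>.integrableOn_compact isCompact_Icc)
  rw [← (PiLp.volume_preserving_toLp (Fin (n + 1))).setIntegral_preimage_emb
    (MeasurableEquiv.toLp 2 (Fin (n + 1) → ℝ)).measurableEmbedding]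
  have hset : WithLp.toLp 2 ⁻¹' {x : EuclideanSpace ℝ (Fin (n + 1)) |
      ∀ i, x i ∈ Set.Ioo (-1 : ℝ) 1} = Set.univ.pi fun _ => Set.Ioo (-1 : ℝ) 1 := by
    ext x; simp
  rw [hset, volume_pi, setIntegral_congr_set Measure.univ_pi_Ioo_ae_eq_Icc, ← volume_pi]
  refine Eq.trans ?_ (hdiv.trans ?_)
  · rfl
  · refine Finset.sum_eq_zero fun k _ => ?_
    have h : ∀ t : ℝ, t ^ 2 = 1 → ∀ y : Fin n → ℝ, F k (L (k.insertNth t y)) = 0 :=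
      fun t ht y => hF₀ k _ (by simpa [hL] using ht)
    simp [h]

theorem contDiff_exampleCoeff (k l : Fin 3) {m : WithTop ℕ∞} :
    ContDiff ℝ m (exampleCoeff k l) := by
  unfold exampleCoeff
  fin_cases k <;> fin_cases l <;> simp <;> fun_prop

theorem exampleCoeff_antisymm (k l : Fin 3) (x : EuclideanSpace ℝ (Fin 3)) :
    exampleCoeff k l x = -exampleCoeff l k x := by
  fin_cases k <;> fin_cases l <;> simp [exampleCoeff] <;> ring

theorem exampleCoeff_eq_zero_of_sq_eq_one (k l : Fin 3) (x : EuclideanSpace ℝ (Fin 3))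
    (hx : x k ^ 2 = 1) : exampleCoeff k l x = 0 := by
  obtain hx | hx := (by simpa using hx : x k = 1 ∨ x k = -1) <;> fin_cases k <;> fin_cases l <;>
    simp_all [exampleCoeff]

/-- The columns of `exampleCoeff` are divergence-free. -/
theorem sum_fderiv_exampleCoeff (l : Fin 3) (x : EuclideanSpace ℝ (Fin 3)) :
    ∑ k, fderiv ℝ (exampleCoeff k l) x (EuclideanSpace.single k 1) = 0 := by
  have hline : ∀ k, fderiv ℝ (exampleCoeff k l) x (EuclideanSpace.single k 1) =
      deriv (fun t : ℝ => exampleCoeff k l (x + t • EuclideanSpace.single k 1)) 0 := fun k =>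
    (((contDiff_exampleCoeff k l (m := 1)).differentiable one_ne_zero) x).lineDeriv_eq_fderiv.symm
  have hsq : ∀ a : ℝ, deriv (fun t : ℝ => (a + t) ^ 2) 0 = 2 * a := fun a => by
    simpa using (((hasDerivAt_id (0 : ℝ)).const_add a).fun_pow 2).deriv
  simp_rw [hline]
  unfold exampleCoeff
  fin_cases l <;> simp [Fin.sum_univ_three, PiLp.single_apply, hsq] <;> ring

theorem contDiff_partialDerivC3 {φ : EuclideanSpace ℝ (Fin 3) → ℂ} (hφ : ContDiff ℝ 2 φ)
    (l : Fin 3) : ContDiff ℝ 1 (partialDerivC3 φ l) :=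
  (hφ.fderiv_right (m := 1) (by norm_num)).clm_apply contDiff_const

theorem partialDerivC3_comm {φ : EuclideanSpace ℝ (Fin 3) → ℂ} (hφ : ContDiff ℝ 2 φ)
    (k l : Fin 3) (x : EuclideanSpace ℝ (Fin 3)) :
    partialDerivC3 (partialDerivC3 φ l) k x = partialDerivC3 (partialDerivC3 φ k) l x := by
  have h : ∀ i j, partialDerivC3 (partialDerivC3 φ i) j x =
      fderiv ℝ (fderiv ℝ φ) x (EuclideanSpace.single j 1) (EuclideanSpace.single i 1) := by
    intro i j
    have hd : DifferentiableAt ℝ (fderiv ℝ φ) x :=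
      (hφ.fderiv_right (m := 1) (by norm_num)).differentiable one_ne_zero x
    change fderiv ℝ (fun y => fderiv ℝ φ y (EuclideanSpace.single i 1)) x _ = _
    rw [fderiv_clm_apply hd (by fun_prop)]
    simp
  rw [h, h]
  exact hφ.contDiffAt.isSymmSndFDerivAt (by simp) _ _

/-- The integrand of the form is the divergence of `k ↦ ∑ l, c_kl ∂_l φ conj ψ`. -/
theorem sum_partialDerivC3_flux {φ ψ : EuclideanSpace ℝ (Fin 3) → ℂ}
    (hφ : ContDiff ℝ 2 φ) (hψ : ContDiff ℝ 1 ψ) (x : EuclideanSpace ℝ (Fin 3)) :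
    ∑ k, fderiv ℝ (fun y => ∑ l, (exampleCoeff k l y : ℂ) * partialDerivC3 φ l y *
        (starRingEnd ℂ) (ψ y)) x (EuclideanSpace.single k 1) =
      ∑ k, ∑ l, (exampleCoeff k l x : ℂ) * partialDerivC3 φ l x *
        (starRingEnd ℂ) (partialDerivC3 ψ k x) := by
  have hterm : ∀ k l, HasFDerivAt (fun y => (exampleCoeff k l y : ℂ) * partialDerivC3 φ l y *
      (starRingEnd ℂ) (ψ y)) _ x := fun k l =>
    ((Complex.ofRealCLM.hasFDerivAt.comp x ((contDiff_exampleCoeff k l (m := 1)).differentiable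
      one_ne_zero x).hasFDerivAt).mul
      ((contDiff_partialDerivC3 hφ l).differentiable one_ne_zero x).hasFDerivAt).mul
      (hψ.differentiable one_ne_zero x).hasFDerivAt.star
  have hfd : ∀ k, fderiv ℝ (fun y => ∑ l, (exampleCoeff k l y : ℂ) * partialDerivC3 φ l y *
        (starRingEnd ℂ) (ψ y)) x (EuclideanSpace.single k 1) =
      ∑ l, ((exampleCoeff k l x : ℂ) * partialDerivC3 φ l x *
          (starRingEnd ℂ) (partialDerivC3 ψ k x) +
        ((exampleCoeff k l x : ℂ) * partialDerivC3 (partialDerivC3 φ l) k x +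
          partialDerivC3 φ l x *
            (fderiv ℝ (exampleCoeff k l) x (EuclideanSpace.single k 1) : ℝ)) *
          (starRingEnd ℂ) (ψ x)) := by
    intro k
    rw [(HasFDerivAt.fun_sum fun l _ => hterm k l).fderiv, sum_apply]
    refine Finset.sum_congr rfl fun l _ => ?_
    simp [partialDerivC3]
    ring
  have hdiv : ∀ l, ∑ k, ((fderiv ℝ (exampleCoeff k l) x (EuclideanSpace.single k 1) : ℝ) : ℂ)
      = 0 := fun l => by
    rw [← Complex.ofReal_sum, sum_fderiv_exampleCoeff, Complex.ofReal_zero]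
  have hsymm : ∑ k, ∑ l, (exampleCoeff k l x : ℂ) * partialDerivC3 (partialDerivC3 φ l) k x
      = 0 := by
    refine self_eq_neg.mp ?_
    conv_lhs => rw [Finset.sum_comm]
    simp_rw [← Finset.sum_neg_distrib]
    refine Finset.sum_congr rfl fun k _ => Finset.sum_congr rfl fun l _ => ?_
    rw [exampleCoeff_antisymm l k, partialDerivC3_comm hφ l k]
    simp
  have hlast : ∑ k, ∑ l, partialDerivC3 φ l x *
      ((fderiv ℝ (exampleCoeff k l) x (EuclideanSpace.single k 1) : ℝ) : ℂ) = 0 := by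
    rw [Finset.sum_comm]
    simp_rw [← Finset.mul_sum, hdiv, mul_zero, Finset.sum_const_zero]
  simp_rw [hfd, Finset.sum_add_distrib, ← Finset.sum_mul, Finset.sum_add_distrib, hsymm, hlast]
  simp

/-- The form with coefficients `exampleCoeff` vanishes identically on smooth functions. -/
theorem example_form_eq_zero (φ ψ : EuclideanSpace ℝ (Fin 3) → ℂ)
    (hφ : ContDiff ℝ (⊤ : ℕ∞) φ) (hψ : ContDiff ℝ (⊤ : ℕ∞) ψ) :
    ∑ k : Fin 3, ∑ l : Fin 3,
      ∫ x in {x : EuclideanSpace ℝ (Fin 3) | ∀ i, x i ∈ Set.Ioo (-1 : ℝ) 1},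
        (exampleCoeff k l x : ℂ) * partialDerivC3 φ l x *
          (starRingEnd ℂ) (partialDerivC3 ψ k x) = 0 := by
  have hφ₂ : ContDiff ℝ 2 φ := hφ.of_le (by norm_cast)
  have hψ₂ : ContDiff ℝ 2 ψ := hψ.of_le (by norm_cast)
  have hint : ∀ k l, IntegrableOn (fun x => (exampleCoeff k l x : ℂ) * partialDerivC3 φ l x *
      (starRingEnd ℂ) (partialDerivC3 ψ k x))
      {x : EuclideanSpace ℝ (Fin 3) | ∀ i, x i ∈ Set.Ioo (-1 : ℝ) 1} := fun k l =>
    Continuous.integrableOn_openCube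
      (((Complex.continuous_ofReal.comp (contDiff_exampleCoeff k l (m := 1)).continuous).mul
        (contDiff_partialDerivC3 hφ₂ l).continuous).mul
        (Complex.continuous_conj.comp (contDiff_partialDerivC3 hψ₂ k).continuous))
  simp_rw [← integral_finsetSum _ fun l _ => hint _ l]
  rw [← integral_finsetSum _ fun k _ => integrable_finsetSum _ fun l _ => hint k l]
  simp_rw [← sum_partialDerivC3_flux hφ₂ (hψ₂.of_le one_le_two)]
  refine integral_openCube_divergence_eq_zero _ (fun k => ?_) fun k x hx => ?_
  · exact ContDiff.sum fun l _ => ((Complex.ofRealCLM.contDiff.comp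
      (contDiff_exampleCoeff k l)).mul (contDiff_partialDerivC3 hφ₂ l)).mul
      (Complex.conjCLE.contDiff.comp (hψ₂.of_le one_le_two))
  · simp [exampleCoeff_eq_zero_of_sq_eq_one k _ x hx]
end
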